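/- Let d ≥ 2 and n ≥ 1 be integers and let t be an integer with 0 ≤ t ≤ n−1. Say two d-ary strings of length n are in the same window if they agree in their first n−t coordinates. Let a be a d-ary string of length n and let B be a nonempty finite set of d-ary strings of length n all lying in one common window. Let S be a finite set of pairs (u,v) of d-ary strings of length n such that: (i) u ≠ a and v ∉ B for every (u,v) ∈ S; (ii) distinct elements of S have distinct second components; (iii) if (u,v) and (u,v') are distinct elements of S with the same first component, then v and v' are not in the same window; and (iv) every (u,v) ∈ S satisfies suf(u_{1..n−1}, a_{1..n−1}) + pre(v_{1..n−1}, b_{1..n−1}) ≥ n for some b ∈ B. Then: if t ≤ ⌊n/2⌋ − 1, |S| ≤ d^{n−2t−1} + t·(d−1)·d^{n−t−1} − 1; and if t ≥ ⌊n/2⌋, then (as an inequality of rational numbers, where the exponent 2t−n−1 may be negative) |S| < [ (d−1)(n−t−1) − 1 ]·d^{n−t−1} + d^t − (d−1)·d^{2t−n−1} + 1. -/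

import Mathlib

/-- Length of the longest common prefix of the `(n-1)`-prefixes `s₁⋯s_{n-1}` and
`s'₁⋯s'_{n-1}` of two `d`-ary strings of length `n`: the largest `p ≤ n-1` such
that `s i = s' i` for all (0-indexed) `i < p`. -/
def strPre (d n : ℕ) (s s' : Fin n → Fin d) : ℕ :=
  ((Finset.range n).filter (fun p => ∀ i : Fin n, (i : ℕ) < p → s i = s' i)).sup id

/-- Length of the longest common suffix of the `(n-1)`-prefixes `s₁⋯s_{n-1}` and
`s'₁⋯s'_{n-1}` of two `d`-ary strings of length `n`: the largest `q ≤ n-1` such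
that `s i = s' i` for all (0-indexed) `i` with `n-1-q ≤ i < n-1`. -/
def strSuf (d n : ℕ) (s s' : Fin n → Fin d) : ℕ :=
  ((Finset.range n).filter
    (fun q => ∀ i : Fin n, n - 1 - q ≤ (i : ℕ) → (i : ℕ) < n - 1 → s i = s' i)).sup id

open Classical in
lemma aux_pre (d n : ℕ) (hn : 1 ≤ n) (s s' : Fin n → Fin d) :
    strPre d n s s' < n ∧ ∀ i : Fin n, (i : ℕ) < strPre d n s s' → s i = s' i := by
  obtain ⟨x, hx, he⟩ := Finset.exists_mem_eq_sup
    ((Finset.range n).filter (fun p => ∀ i : Fin n, (i : ℕ) < p → s i = s' i))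
    ⟨0, by simp; omega⟩ id
  have : strPre d n s s' = x := by
    unfold strPre
    convert he
    rfl
  rw [this]
  simpa using hx

open Classical in
lemma aux_suf (d n : ℕ) (hn : 1 ≤ n) (s s' : Fin n → Fin d) :
    strSuf d n s s' < n ∧ ∀ i : Fin n, n - 1 - strSuf d n s s' ≤ (i : ℕ) → (i : ℕ) < n - 1 →
      s i = s' i := by
  obtain ⟨x, hx, he⟩ := Finset.exists_mem_eq_sup
    ((Finset.range n).filter
      (fun q => ∀ i : Fin n, n - 1 - q ≤ (i : ℕ) → (i : ℕ) < n - 1 → s i = s' i))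
    ⟨0, by simp; refine ⟨by omega, fun i h1 h2 => by omega⟩⟩ id
  have : strSuf d n s s' = x := by
    unfold strSuf
    convert he
    rfl
  rw [this]
  simpa using hx

open Classical in
/-- functions agreeing with `c` on `Q` -/
noncomputable def agr (d n : ℕ) (c : Fin n → Fin d) (Q : ℕ → Prop) : Finset (Fin n → Fin d) :=
  Finset.univ.filter (fun f => ∀ i : Fin n, Q i → f i = c i)

lemma mem_agr {d n : ℕ} {c : Fin n → Fin d} {Q : ℕ → Prop} {f : Fin n → Fin d} :
    f ∈ agr d n c Q ↔ ∀ i : Fin n, Q i → f i = c i := by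
  simp [agr]

open Classical in
lemma card_agr (d n : ℕ) (c : Fin n → Fin d) (Q : ℕ → Prop) :
    (agr d n c Q).card = d ^ ((Finset.range n).filter (fun i => ¬ Q i)).card := by
  have h : agr d n c Q = Fintype.piFinset (fun i : Fin n => if Q i then {c i} else Finset.univ) := by
    ext f
    rw [mem_agr, Fintype.mem_piFinset]
    refine forall_congr' fun i => ?_
    by_cases hq : Q i <;> simp [hq]
  rw [h, Fintype.card_piFinset]
  have : ∀ i : Fin n, (if Q i then ({c i} : Finset (Fin d)) else Finset.univ).card
      = (fun j : ℕ => if Q j then 1 else d) i := by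
    intro i
    by_cases hq : Q i <;> simp [hq]
  rw [Finset.prod_congr rfl (fun i _ => this i), Fin.prod_univ_eq_prod_range (fun j : ℕ => if Q j then 1 else d) n,
    Finset.prod_ite]
  simp

lemma card_agr_mid (d n : ℕ) (c : Fin n → Fin d) (p q : ℕ) (hq : q ≤ n) :
    (agr d n c (fun i => i < p ∨ q ≤ i)).card = d ^ (q - p) := by
  classical
  rw [card_agr]
  congr 1
  rw [← Nat.card_Ico]
  congr 1
  ext i
  simp
  omega

lemma card_agr_pre (d n : ℕ) (c : Fin n → Fin d) (p : ℕ) :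
    (agr d n c (fun i => i < p)).card = d ^ (n - p) := by
  classical
  rw [card_agr]
  congr 1
  rw [← Nat.card_Ico]
  congr 1
  ext i
  simp
  omega

lemma card_agr_suf (d n : ℕ) (c : Fin n → Fin d) (p : ℕ) (hp : 1 ≤ p) (hpn : p ≤ n) :
    (agr d n c (fun i => p - 1 ≤ i ∧ i < n - 1)).card = d ^ p := by
  classical
  rw [card_agr]
  congr 1
  have h3 : (Finset.range n).filter (fun i => ¬ (p - 1 ≤ i ∧ i < n - 1)) =
      Finset.range (p - 1) ∪ Finset.Ico (n - 1) n := by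
    ext i
    simp
    omega
  have h4 : Disjoint (Finset.range (p - 1)) (Finset.Ico (n - 1) n) := by
    rw [Finset.disjoint_left]
    intro i hi hj
    simp at hi hj
    omega
  have h5 := Finset.card_union_of_disjoint h4
  rw [← h3, Finset.card_range, Nat.card_Ico] at h5
  trans (p - 1 + (n - (n - 1)))
  · rw [← h5]
    congr!
  · omega

open Classical in
/-- functions in the middle shape with first disagreement at `p` -/
lemma card_dis (d n : ℕ) (c : Fin n → Fin d) (p q : ℕ) (hpq : p < q) (hq : q ≤ n) :
    ((agr d n c (fun i => i < p ∨ q ≤ i)) \ (agr d n c (fun i => i < p + 1 ∨ q ≤ i))).card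
      = (d - 1) * d ^ (q - p - 1) := by
  rw [Finset.card_sdiff_of_subset, card_agr_mid _ _ _ _ _ hq, card_agr_mid _ _ _ _ _ hq]
  · obtain ⟨k, rfl⟩ : ∃ k, q = p + 1 + k := ⟨q - p - 1, by omega⟩
    rw [show p + 1 + k - p = k + 1 by omega, show p + 1 + k - (p + 1) = k by omega,
      show k + 1 - 1 = k by omega, pow_succ, Nat.sub_mul, one_mul, mul_comm]
  · intro f hf
    rw [mem_agr] at *
    intro i hi
    exact hf i (by omega)

/-- The sum estimate. -/
lemma sum_bound (d n t : ℕ) (hd : 2 ≤ d) (htn : t + 1 ≤ n) (s : ℕ → ℕ) (h0 : s 0 = 0)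
    (h1 : ∀ p, 1 ≤ p → p < n - t → s p ≤ (d ^ p - 1) * ((d - 1) * d ^ (n - t - p - 1)))
    (k : ℕ) (hk : k + 1 ≤ n - t) :
    (∑ p ∈ Finset.range (k + 1), (s p : ℤ)) ≤
      k * (d - 1) * d ^ (n - t - 1) - d ^ (n - t - 1) + d ^ (n - t - (k + 1)) := by
  induction k with
  | zero => simp [h0]
  | succ k ih =>
    rw [Finset.sum_range_succ]
    have h := h1 (k + 1) (by omega) (by omega)
    have ih := ih (by omega)
    obtain ⟨m, hm⟩ : ∃ m, n - t = m + 1 + (k + 1) := ⟨n - t - (k + 2), by omega⟩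
    rw [hm] at h ih ⊢
    have e1 : m + 1 + (k + 1) - (k + 1) - 1 = m := by omega
    have e2 : m + 1 + (k + 1) - (k + 1 + 1) = m := by omega
    have e3 : m + 1 + (k + 1) - (k + 1) = m + 1 := by omega
    have e4 : m + 1 + (k + 1) - 1 = m + (k + 1) := by omega
    rw [e1] at h
    rw [e3, e4] at ih
    rw [e2, e4]
    have hz : (s (k + 1) : ℤ) ≤ ((d : ℤ) ^ (k + 1) - 1) * ((d - 1) * d ^ m) := by
      have hp : 1 ≤ d ^ (k + 1) := Nat.one_le_pow _ _ (by omega)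
      have : ((s (k + 1) : ℕ) : ℤ) ≤ (((d ^ (k + 1) - 1) * ((d - 1) * d ^ m) : ℕ) : ℤ) := by
        exact_mod_cast h
      push_cast [Nat.cast_sub hp, Nat.cast_sub (show 1 ≤ d by omega)] at this
      exact this
    push_cast
    have e5 : (d : ℤ) ^ (m + (k + 1)) = d ^ (k + 1) * d ^ m := by rw [pow_add]; ring
    have e6 : (d : ℤ) ^ (m + 1) = d * d ^ m := by rw [pow_succ]; ring
    rw [e5, e6] at ih
    rw [e5]
    linarith

lemma sum_bound2 (d n t : ℕ) (hd : 2 ≤ d) (s : ℕ → ℕ) (C : ℤ) 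
    (hC : (∑ p ∈ Finset.range (t + 1), (s p : ℤ)) ≤ C - d ^ (n - (t + 1)))
    (h2 : ∀ p, p < n - t → s p ≤ (d - 1) * d ^ (n - p - 1))
    (k : ℕ) (hk : t + 1 + k ≤ n - t) :
    (∑ p ∈ Finset.range (t + 1 + k), (s p : ℤ)) ≤ C - d ^ (n - (t + 1 + k)) := by
  induction k with
  | zero => simpa using hC
  | succ k ih =>
    rw [← add_assoc, Finset.sum_range_succ]
    have h := h2 (t + 1 + k) (by omega)
    have ih := ih (by omega)
    obtain ⟨m, hm⟩ : ∃ m, n = m + 1 + (t + 1 + k) := ⟨n - (t + 1 + k + 1), by omega⟩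
    rw [show n - (t + 1 + k) - 1 = m by omega] at h
    rw [show n - (t + 1 + k) = m + 1 by omega] at ih
    rw [show n - (t + 1 + k + 1) = m by omega]
    have hz : (s (t + 1 + k) : ℤ) ≤ ((d : ℤ) - 1) * d ^ m := by
      have : ((s (t + 1 + k) : ℕ) : ℤ) ≤ (((d - 1) * d ^ m : ℕ) : ℤ) := by
        exact_mod_cast h
      push_cast [Nat.cast_sub (show 1 ≤ d by omega)] at this
      exact this
    rw [pow_succ] at ih
    linarith

/-- Multicast WSNB bound for the window algorithm with window size `d^t`
(Theorems 1 and 2 of Danilewicz 2007). Two strings are in the same window if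
they agree in their first `n-t` coordinates. `B` lies in one window, `S` is a
set of pairs `(u,v)` link-blocking the request `(a,B)`, with distinct second
components, and for a common first component the second components lie in
distinct windows. Then `|S| ≤ d^{n-2t-1} + t(d-1)d^{n-t-1} - 1` when
`t ≤ ⌊n/2⌋ - 1`, and (as rationals, with possibly negative exponent `2t-n-1`)
`|S| < [(d-1)(n-t-1) - 1] d^{n-t-1} + d^t - (d-1) d^{2t-n-1} + 1` when
`t ≥ ⌊n/2⌋`. -/
theorem stmt_18 (d n t : ℕ) (hd : 2 ≤ d) (hn : 1 ≤ n) (ht : t ≤ n - 1)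
    (a : Fin n → Fin d)
    (B : Finset (Fin n → Fin d)) (hBne : B.Nonempty)
    (hB : ∀ b ∈ B, ∀ b' ∈ B, ∀ i : Fin n, (i : ℕ) < n - t → b i = b' i)
    (S : Finset ((Fin n → Fin d) × (Fin n → Fin d)))
    (h1 : ∀ p ∈ S, p.1 ≠ a ∧ p.2 ∉ B)
    (h2 : ∀ p ∈ S, ∀ q ∈ S, p ≠ q → p.2 ≠ q.2)
    (h3 : ∀ p ∈ S, ∀ q ∈ S, p ≠ q → p.1 = q.1 →
      ¬ (∀ i : Fin n, (i : ℕ) < n - t → p.2 i = q.2 i))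
    (h4 : ∀ p ∈ S, ∃ b ∈ B, n ≤ strSuf d n p.1 a + strPre d n p.2 b) :
    (t + 1 ≤ n / 2 →
      S.card ≤ d ^ (n - 2 * t - 1) + t * (d - 1) * d ^ (n - t - 1) - 1) ∧
    (n / 2 ≤ t →
      (S.card : ℚ) <
        (((d : ℚ) - 1) * ((n : ℚ) - (t : ℚ) - 1) - 1) * (d : ℚ) ^ (n - t - 1)
          + (d : ℚ) ^ t
          - ((d : ℚ) - 1) * (d : ℚ) ^ (2 * (t : ℤ) - (n : ℤ) - 1) + 1) := by
  classical
  obtain ⟨b0, hb0⟩ := hBne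
  -- the classes
  set W := S.filter (fun p => p.2 ∈ agr d n b0 (fun i => i < n - t)) with hW
  set D : ℕ → Finset ((Fin n → Fin d) × (Fin n → Fin d)) := fun k =>
    S.filter (fun p => p.2 ∈ agr d n b0 (fun i => i < k) ∧ p.2 ∉ agr d n b0 (fun i => i < k + 1))
    with hD
  have hcover : ∀ k, S ⊆ S.filter (fun p => p.2 ∈ agr d n b0 (fun i => i < k)) ∪
      (Finset.range k).biUnion D := by
    intro k
    induction k with
    | zero => 
      intro p hp
      simp [hp, mem_agr]
    | succ k ih =>
      intro p hp
      have := ih hp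
      rw [Finset.mem_union] at this ⊢
      rcases this with h | h
      · by_cases hh : p.2 ∈ agr d n b0 (fun i => i < k + 1)
        · left
          exact Finset.mem_filter.2 ⟨hp, hh⟩
        · right
          rw [Finset.mem_biUnion]
          refine ⟨k, by simp, ?_⟩
          simp only [hD, Finset.mem_filter] at h ⊢
          exact ⟨hp, h.2, hh⟩
      · right
        rw [Finset.mem_biUnion] at h ⊢
        obtain ⟨j, hj, hj2⟩ := h
        exact ⟨j, by simp at hj ⊢; omega, hj2⟩
  have hcard : S.card ≤ W.card + ∑ k ∈ Finset.range (n - t), (D k).card :=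
    (Finset.card_le_card (hcover (n - t))).trans
      ((Finset.card_union_le _ _).trans (Nat.add_le_add_left Finset.card_biUnion_le _))
  -- suffix information
  have hsuf : ∀ p ∈ S, ∀ k, (∀ b ∈ B, strPre d n p.2 b ≤ k) →
      1 ≤ k ∧ p.1 ∈ (agr d n a (fun i => k - 1 ≤ i ∧ i < n - 1)).erase a := by
    intro p hp k hk
    obtain ⟨b, hb, hh⟩ := h4 p hp
    have h5 := hk b hb
    obtain ⟨h6, h7⟩ := aux_suf d n hn p.1 a
    refine ⟨by omega, ?_⟩
    rw [Finset.mem_erase, mem_agr]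
    exact ⟨(h1 p hp).1, fun i hi => h7 i (by omega) hi.2⟩
  have hcsuf : ∀ k, 1 ≤ k → k ≤ n →
      ((agr d n a (fun i => k - 1 ≤ i ∧ i < n - 1)).erase a).card = d ^ k - 1 := by
    intro k hk hkn
    rw [Finset.card_erase_of_mem (by rw [mem_agr]; intros; rfl), card_agr_suf _ _ _ _ hk hkn]
  have hDpre : ∀ k < n - t, ∀ p ∈ D k, ∀ b ∈ B, strPre d n p.2 b ≤ k := by
    intro k hk p hp b hb
    simp only [hD, Finset.mem_filter] at hp
    by_contra hcon
    push Not at hcon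
    apply hp.2.2
    rw [mem_agr]
    intro i hi
    rw [(aux_pre d n hn p.2 b).2 i (by omega)]
    exact hB b hb b0 hb0 i (by omega)
  have hD0 : (D 0).card = 0 := by
    rw [Finset.card_eq_zero, Finset.eq_empty_iff_forall_notMem]
    intro p hp
    have := (hsuf p (Finset.mem_filter.1 hp).1 0 (hDpre 0 (by omega) p hp)).1
    omega
  have hDv : ∀ k, k < n - t → (D k).card ≤ (d - 1) * d ^ (n - k - 1) := by
    intro k hk
    rw [← card_dis d n b0 k n (by omega) le_rfl]
    apply Finset.card_le_card_of_injOn (fun p => p.2)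
    · intro p hp
      simp only [hD, Finset.coe_filter, Set.mem_ofPred_eq] at hp
      obtain ⟨hp, h5, h6⟩ := hp
      simp only [Finset.coe_sdiff, Set.mem_sdiff, Finset.mem_coe, mem_agr] at *
      refine ⟨fun i hi => h5 i (by omega), fun hh => h6 fun i hi => hh i (by omega)⟩
    · intro p hp q hq hpq
      by_contra hne
      exact h2 p (Finset.mem_filter.1 hp).1 q (Finset.mem_filter.1 hq).1 hne hpq
  have hDu : ∀ k, 1 ≤ k → k < n - t →
      (D k).card ≤ (d ^ k - 1) * ((d - 1) * d ^ (n - t - k - 1)) := by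
    intro k hk1 hk
    rw [← card_dis d n b0 k (n - t) (by omega) (by omega), ← hcsuf k hk1 (by omega),
      ← Finset.card_product]
    apply Finset.card_le_card_of_injOn
      (fun p => (p.1, fun i : Fin n => if (i : ℕ) < n - t then p.2 i else b0 i))
    · intro p hp
      have hs := (hsuf p (Finset.mem_filter.1 hp).1 k (hDpre k hk p hp)).2
      simp only [hD, Finset.coe_filter, Set.mem_ofPred_eq] at hp
      obtain ⟨hp, h5, h6⟩ := hp
      rw [Finset.mem_coe, Finset.mem_product]
      refine ⟨hs, ?_⟩
      simp only [Finset.mem_sdiff, mem_agr] at *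
      refine ⟨fun i hi => ?_, fun hh => h6 fun i hi => ?_⟩
      · split_ifs with h7
        · exact h5 i (by omega)
        · rfl
      · have := hh i (by omega)
        rwa [if_pos (by omega)] at this
    · intro p hp q hq hpq
      by_contra hne
      simp only [Prod.mk.injEq] at hpq
      apply h3 p (Finset.mem_filter.1 hp).1 q (Finset.mem_filter.1 hq).1 hne hpq.1
      intro i hi
      have := congrFun hpq.2 i
      simpa [hi] using this
  have hBsub : B ⊆ agr d n b0 (fun i => i < n - t) := by
    intro b hb
    rw [mem_agr]
    exact fun i hi => hB b hb b0 hb0 i hi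
  have hWB : W.card + B.card ≤ d ^ t := by
    have h5 : W.card ≤ (agr d n b0 (fun i => i < n - t) \ B).card := by
      apply Finset.card_le_card_of_injOn (fun p => p.2)
      · intro p hp
        have hp := Finset.mem_filter.1 (Finset.mem_coe.1 hp)
        rw [Finset.mem_coe, Finset.mem_sdiff]
        exact ⟨hp.2, (h1 p hp.1).2⟩
      · intro p hp q hq hpq
        by_contra hne
        exact h2 p (Finset.mem_filter.1 hp).1 q (Finset.mem_filter.1 hq).1 hne hpq
    have h6 := Finset.card_sdiff_add_card_eq_card hBsub
    rw [card_agr_pre, show n - (n - t) = t by omega] at h6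
    omega
  have hB1 : 1 ≤ B.card := Finset.card_pos.2 ⟨b0, hb0⟩
  have hdt : 1 ≤ d ^ t := Nat.one_le_pow _ _ (by omega)
  have hcardZ : (S.card : ℤ) ≤ W.card + ∑ k ∈ Finset.range (n - t), ((D k).card : ℤ) := by
    exact_mod_cast hcard
  have hsum := sum_bound d n t hd (by omega) (fun k => (D k).card) hD0 hDu
  refine ⟨fun hcase => ?_, fun hcase => ?_⟩
  · have hA := hsum t (by omega)
    have hBd := sum_bound2 d n t hd (fun k => (D k).card)
      (t * (d - 1) * d ^ (n - t - 1) + d ^ (n - 2 * t - 1))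
      (by
        rw [show n - t - (t + 1) = n - 2 * t - 1 by omega] at hA
        rw [show n - (t + 1) = n - t - 1 by omega]
        linarith) hDv (n - t - (t + 1)) (by omega)
    rw [show t + 1 + (n - t - (t + 1)) = n - t by omega, show n - (n - t) = t by omega] at hBd
    have hWz : (W.card : ℤ) + 1 ≤ (d : ℤ) ^ t := by
      have : W.card + 1 ≤ d ^ t := by omega
      exact_mod_cast this
    have hfin : (S.card : ℤ) + 1 ≤ t * (d - 1) * d ^ (n - t - 1) + d ^ (n - 2 * t - 1) := by
      linarith
    have : S.card + 1 ≤ t * (d - 1) * d ^ (n - t - 1) + d ^ (n - 2 * t - 1) := by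
      zify [show 1 ≤ d by omega]
      exact hfin
    omega
  · have hA := hsum (n - t - 1) (by omega)
    rw [show n - t - 1 + 1 = n - t by omega, Nat.sub_self, pow_zero] at hA
    have hAq : (S.card : ℚ) ≤ W.card + (((d : ℚ) - 1) * ((n : ℚ) - t - 1) * d ^ (n - t - 1)
        - d ^ (n - t - 1) + 1) := by
      have h5 : (S.card : ℤ) ≤ W.card + (((n - t - 1 : ℕ) : ℤ) * (d - 1) * d ^ (n - t - 1)
        - d ^ (n - t - 1) + 1) := by
        linarith
      have h6 : (S.card : ℚ) ≤ W.card + (((n - t - 1 : ℕ) : ℚ) * (d - 1) * d ^ (n - t - 1)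
        - d ^ (n - t - 1) + 1) := by
        exact_mod_cast h5
      have h7 : ((n - t - 1 : ℕ) : ℚ) = (n : ℚ) - t - 1 := by
        rw [Nat.cast_sub (by omega), Nat.cast_sub (by omega)]
        simp
      rw [h7] at h6
      linarith
    suffices hWq : (W.card : ℚ) < (d : ℚ) ^ t - ((d : ℚ) - 1) * (d : ℚ) ^ (2 * (t : ℤ) - (n : ℤ) - 1) by
      linarith
    have hd' : (2 : ℚ) ≤ d := by exact_mod_cast hd
    rcases Nat.lt_or_ge (2 * t) (n + 1) with hlt | hge
    · have hWz : (W.card : ℚ) + 1 ≤ (d : ℚ) ^ t := by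
        have : W.card + 1 ≤ d ^ t := by omega
        exact_mod_cast this
      have h5 : (d : ℚ) ^ (2 * (t : ℤ) - (n : ℤ) - 1) ≤ (d : ℚ) ^ (-1 : ℤ) :=
        zpow_le_zpow_right₀ (by linarith) (by omega)
      have h6 : ((d : ℚ) - 1) * (d : ℚ) ^ (2 * (t : ℤ) - (n : ℤ) - 1) ≤ (d - 1) * (d : ℚ) ^ (-1 : ℤ) :=
        mul_le_mul_of_nonneg_left h5 (by linarith)
      have h7 : ((d : ℚ) - 1) * (d : ℚ) ^ (-1 : ℤ) < 1 := by
        rw [zpow_neg_one, ← div_eq_mul_inv, div_lt_one (by linarith)]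
        linarith
      linarith
    · obtain ⟨e, he⟩ : ∃ e, 2 * t = n + 1 + e := ⟨2 * t - (n + 1), by omega⟩
      rw [show 2 * (t : ℤ) - (n : ℤ) - 1 = (e : ℤ) by omega, zpow_natCast]
      -- second estimate on W
      have hW2 : W.card + B.card ≤ (d ^ (t - 1) - 1) + B.card * d ^ (n - t) := by
        set U := B.biUnion (fun b => agr d n b (fun i => i < t)) with hU
        have hBU : B ⊆ U := by
          intro b hb
          rw [hU, Finset.mem_biUnion]
          exact ⟨b, hb, by rw [mem_agr]; intros; rfl⟩
        have hUc : U.card ≤ B.card * d ^ (n - t) := by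
          apply Finset.card_biUnion_le_card_mul
          intro b _
          rw [card_agr_pre]
        have hs := Finset.card_filter_add_card_filter_not (s := W) (fun p => p.2 ∈ U)
        have hg1 : (W.filter (fun p => p.2 ∈ U)).card ≤ (U \ B).card := by
          apply Finset.card_le_card_of_injOn (fun p => p.2)
          · intro p hp
            have hp := Finset.mem_filter.1 (Finset.mem_coe.1 hp)
            rw [Finset.mem_coe, Finset.mem_sdiff]
            exact ⟨hp.2, (h1 p (Finset.mem_filter.1 hp.1).1).2⟩
          · intro p hp q hq hpq
            by_contra hne
            exact h2 p (Finset.mem_filter.1 (Finset.mem_filter.1 hp).1).1 q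
              (Finset.mem_filter.1 (Finset.mem_filter.1 hq).1).1 hne hpq
        have hg2 : (W.filter (fun p => ¬ p.2 ∈ U)).card ≤ d ^ (t - 1) - 1 := by
          rw [← hcsuf (t - 1) (by omega) (by omega)]
          apply Finset.card_le_card_of_injOn (fun p => p.1)
          · intro p hp
            have hp := Finset.mem_filter.1 (Finset.mem_coe.1 hp)
            refine (hsuf p (Finset.mem_filter.1 hp.1).1 (t - 1) ?_).2
            intro b hb
            by_contra hcon
            apply hp.2
            rw [hU, Finset.mem_biUnion]
            refine ⟨b, hb, ?_⟩
            rw [mem_agr]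
            intro i hi
            exact (aux_pre d n hn p.2 b).2 i (by omega)
          · intro p hp q hq hpq
            by_contra hne
            have hp := Finset.mem_filter.1 (Finset.mem_filter.1 hp).1
            have hq := Finset.mem_filter.1 (Finset.mem_filter.1 hq).1
            apply h3 p hp.1 q hq.1 hne hpq
            intro i hi
            rw [mem_agr.1 hp.2 i hi, mem_agr.1 hq.2 i hi]
        have := Finset.card_sdiff_add_card_eq_card hBU
        omega
      have hd1 : 1 ≤ d ^ (t - 1) := Nat.one_le_pow _ _ (by omega)
      have hWBq : (W.card : ℚ) + B.card ≤ (d : ℚ) ^ t := by exact_mod_cast hWB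
      have hW2q : (W.card : ℚ) + B.card + 1 ≤ (d : ℚ) ^ (t - 1) + B.card * d ^ (n - t) := by
        have : W.card + B.card + 1 ≤ d ^ (t - 1) + B.card * d ^ (n - t) := by omega
        exact_mod_cast this
      rcases lt_or_ge (((d : ℚ) - 1) * d ^ e) B.card with hb | hb
      · linarith
      · have h5 : (1 : ℚ) ≤ (d : ℚ) ^ (n - t) := one_le_pow₀ (by linarith)
        have h6 : (B.card : ℚ) * ((d : ℚ) ^ (n - t) - 1) ≤
            (((d : ℚ) - 1) * d ^ e) * ((d : ℚ) ^ (n - t) - 1) :=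
          mul_le_mul_of_nonneg_right hb (by linarith)
        have h7 : (d : ℚ) ^ e * d ^ (n - t) = d ^ (t - 1) := by
          rw [← pow_add]
          congr 1
          omega
        have h8 : (d : ℚ) ^ t = d * d ^ (t - 1) := by
          rw [← pow_succ']
          congr 1
          omega
        have h9 : (((d : ℚ) - 1) * d ^ e) * ((d : ℚ) ^ (n - t) - 1) =
            (d - 1) * d ^ (t - 1) - (d - 1) * d ^ e := by
          rw [← h7]
          ring
        rw [h8]
        linarith
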